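/- arXiv:1712.08699 — 2 statements merged into one kernel-verified Lean document; each statement's English description precedes it below -/
import Mathlib

section
/- For every positive integer w, (5/2)·⌊w/2⌋ ≤ f(w,C_5^+) ≤ 3·⌈w/2⌉. -/
/-!  Common definitions: the online token-coloring game of Milans–Wigal. -/

/-- Tokens `i` and `j` of the play `s` (Spoiler's `i`-th move is at vertex `s i`) are
adjacent in the token graph: they are distinct tokens lying on the same vertex or on
adjacent vertices of `G`. -/
def TokenAdj {V : Type*} (G : SimpleGraph V) (s : ℕ → V) (i j : ℕ) : Prop :=
  i ≠ j ∧ (s i = s j ∨ G.Adj (s i) (s j))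

/-- The play consisting of the first `n` tokens of `s` is legal for Spoiler in the game of
width `w`: the token graph on these `n` tokens has chromatic number at most `w`. -/
def LegalPlay {V : Type*} (G : SimpleGraph V) (w : ℕ) (s : ℕ → V) (n : ℕ) : Prop :=
  ∃ φ : ℕ → ℕ, (∀ i, i < n → φ i < w) ∧
    ∀ i j, i < n → j < n → TokenAdj G s i j → φ i ≠ φ j

/-- The color that Algorithm's (deterministic, online) strategy `σ` assigns to the `i`-th
token of the play `s`: `σ` is applied to the history of Spoiler's moves up to and
including the `i`-th one. -/
def colorOf {V : Type*} (σ : List V → ℕ) (s : ℕ → V) (i : ℕ) : ℕ :=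
  σ (List.ofFn fun j : Fin (i + 1) => s j)

/-- Strategy `σ` for Algorithm wins the token game on `G` of width `w` using at most `k`
colors: against every legal Spoiler play, all assigned colors lie in `{0, …, k-1}` and the
resulting coloring of the token graph is proper. -/
def AlgWins {V : Type*} (G : SimpleGraph V) (w k : ℕ) (σ : List V → ℕ) : Prop :=
  ∀ (n : ℕ) (s : ℕ → V), LegalPlay G w s n →
    (∀ i, i < n → colorOf σ s i < k) ∧
    ∀ i j, i < n → j < n → TokenAdj G s i j → colorOf σ s i ≠ colorOf σ s j

/-- `gameValue G w` is the value `f(w, G)` of the token game on `G` of width `w`: the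
minimum number of colors with which Algorithm has a winning strategy. -/
noncomputable def gameValue {V : Type*} (G : SimpleGraph V) (w : ℕ) : ℕ :=
  sInf {k | ∃ σ : List V → ℕ, AlgWins G w k σ}

/-- `C₅⁺`: the 5-cycle with one added chord, equivalently the complement of the path
`P₅` on 5 vertices. -/
def C5plus : SimpleGraph (Fin 5) := (SimpleGraph.pathGraph 5)ᶜ

open Finset in
/-- In a legal play of width `w`, a family of pairwise adjacent tokens has at most `w` members. -/
lemma LegalPlay.card_le {V : Type*} {G : SimpleGraph V} {w n : ℕ} {s : ℕ → V}
    (hs : LegalPlay G w s n) (T : Finset ℕ) (hT : ∀ i ∈ T, i < n)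
    (hadj : ∀ i ∈ T, ∀ j ∈ T, i ≠ j → TokenAdj G s i j) : #T ≤ w := by
  obtain ⟨φ, hφ, hne⟩ := hs
  rw [← card_range w]
  refine card_le_card_of_injOn φ (fun i hi => by simpa using hφ i (hT i hi)) ?_
  intro i hi j hj hij
  by_contra h
  exact hne i j (hT i hi) (hT j hj) (hadj i hi j hj h) hij

/-- The number of tokens that were placed at the vertex `s i` before the `i`-th token. -/
def tokenRank {V : Type*} [DecidableEq V] (s : ℕ → V) (i : ℕ) : ℕ :=
  ((Finset.range i).filter fun j => s j = s i).card

lemma tokenRank_lt_tokenRank {V : Type*} [DecidableEq V] {s : ℕ → V} {i j : ℕ}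
    (hij : i < j) (h : s i = s j) : tokenRank s i < tokenRank s j := by
  apply Finset.card_lt_card
  refine ⟨fun a ha => ?_, fun hsub => ?_⟩
  · simp only [Finset.mem_filter, Finset.mem_range] at ha ⊢
    exact ⟨ha.1.trans hij, ha.2.trans h⟩
  · have : i ∈ (Finset.range i).filter fun j => s j = s i :=
      hsub (by simp [hij, h])
    simp at this

lemma tokenRank_lt {V : Type*} [DecidableEq V] {G : SimpleGraph V} {w n : ℕ} {s : ℕ → V}
    (hs : LegalPlay G w s n) {i : ℕ} (hi : i < n) : tokenRank s i < w := by
  have := hs.card_le (insert i ((Finset.range i).filter fun j => s j = s i))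
    (by
      intro a ha
      simp only [Finset.mem_insert, Finset.mem_filter, Finset.mem_range] at ha
      omega)
    (by
      intro a ha b hb hab
      simp only [Finset.mem_insert, Finset.mem_filter, Finset.mem_range] at ha hb
      refine ⟨hab, Or.inl ?_⟩
      rcases ha with rfl | ha <;> rcases hb with rfl | hb <;> simp_all)
  rw [Finset.card_insert_of_notMem (by simp)] at this
  exact this

lemma tokenRank_add_lt {V : Type*} [DecidableEq V] {G : SimpleGraph V} {w n : ℕ} {s : ℕ → V}
    (hs : LegalPlay G w s n) {i j : ℕ} (hi : i < n) (hj : j < n) (hadj : G.Adj (s i) (s j)) :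
    tokenRank s i + tokenRank s j + 2 ≤ w := by
  set A := insert i ((Finset.range i).filter fun a => s a = s i) with hA
  set B := insert j ((Finset.range j).filter fun a => s a = s j) with hB
  have hAs : ∀ a ∈ A, a < n ∧ s a = s i := by
    intro a ha
    simp only [hA, Finset.mem_insert, Finset.mem_filter, Finset.mem_range] at ha
    rcases ha with rfl | ha
    · exact ⟨hi, rfl⟩
    · exact ⟨ha.1.trans hi, ha.2⟩
  have hBs : ∀ a ∈ B, a < n ∧ s a = s j := by
    intro a ha
    simp only [hB, Finset.mem_insert, Finset.mem_filter, Finset.mem_range] at ha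
    rcases ha with rfl | ha
    · exact ⟨hj, rfl⟩
    · exact ⟨ha.1.trans hj, ha.2⟩
  have hdisj : Disjoint A B := Finset.disjoint_left.2 fun a ha hb =>
    hadj.ne ((hAs a ha).2.symm.trans (hBs a hb).2)
  have := hs.card_le (A ∪ B)
    (by
      intro a ha
      rcases Finset.mem_union.1 ha with h | h
      · exact (hAs a h).1
      · exact (hBs a h).1)
    (by
      intro a ha b hb hab
      refine ⟨hab, ?_⟩
      rcases Finset.mem_union.1 ha with h | h <;> rcases Finset.mem_union.1 hb with h' | h'
      · exact Or.inl ((hAs a h).2.trans (hAs b h').2.symm)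
      · exact Or.inr (by rw [(hAs a h).2, (hBs b h').2]; exact hadj)
      · exact Or.inr (by rw [(hBs a h).2, (hAs b h').2]; exact hadj.symm)
      · exact Or.inl ((hBs a h).2.trans (hBs b h').2.symm))
  rw [Finset.card_union_of_disjoint hdisj, hA, hB, Finset.card_insert_of_notMem (by simp),
    Finset.card_insert_of_notMem (by simp)] at this
  unfold tokenRank
  omega

/-- The strategy coloring a token at `v` preceded by `t` tokens at `v` with `L v t`. -/
def listStrategy {V : Type*} [DecidableEq V] [Inhabited V] (L : V → ℕ → ℕ) (l : List V) : ℕ :=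
  L (l.getD (l.length - 1) default) (tokenRank (fun j => l.getD j default) (l.length - 1))

lemma colorOf_listStrategy {V : Type*} [DecidableEq V] [Inhabited V] (L : V → ℕ → ℕ)
    (s : ℕ → V) (i : ℕ) : colorOf (listStrategy L) s i = L (s i) (tokenRank s i) := by
  have hget : ∀ j ≤ i, (List.ofFn fun j : Fin (i + 1) => s j).getD j default = s j := by
    intro j hj
    rw [List.getD_eq_getElem _ _ (by simp; omega)]
    exact List.getElem_ofFn _
  unfold colorOf listStrategy
  have hlen : (List.ofFn fun j : Fin (i + 1) => s j).length - 1 = i := by simp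
  rw [hlen, hget i le_rfl]
  congr 1
  unfold tokenRank
  congr 1
  apply Finset.filter_congr
  intro j hj
  dsimp only
  rw [hget i le_rfl, hget j (Finset.mem_range.1 hj).le]

/-- Lists of `w` colors, one for each vertex, give a winning strategy as soon as the positions of
a common color in the lists of two adjacent vertices are far enough from the start. -/
lemma algWins_listStrategy {V : Type*} [DecidableEq V] [Inhabited V] {G : SimpleGraph V}
    {w k : ℕ} {L : V → ℕ → ℕ} (hlt : ∀ v, ∀ t < w, L v t < k)
    (hinj : ∀ v, ∀ t < w, ∀ u < w, L v t = L v u → t = u)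
    (hadj : ∀ v v', G.Adj v v' → ∀ t u, t + u + 2 ≤ w → L v t ≠ L v' u) :
    AlgWins G w k (listStrategy L) := by
  intro n s hs
  simp only [colorOf_listStrategy]
  refine ⟨fun i hi => hlt _ _ (tokenRank_lt hs hi), ?_⟩
  rintro i j hi hj ⟨hij, h | h⟩
  · intro hL
    rw [h] at hL
    have := hinj _ _ (tokenRank_lt hs hi) _ (tokenRank_lt hs hj) hL
    rcases lt_or_gt_of_ne hij with hlt | hgt
    · exact (tokenRank_lt_tokenRank hlt h).ne this
    · exact (tokenRank_lt_tokenRank hgt h.symm).ne this.symm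
  · exact hadj _ _ h _ _ (tokenRank_add_lt hs hi hj h)

lemma C5plus_adj {a b : Fin 5} :
    C5plus.Adj a b ↔ a ≠ b ∧ ¬(a.val + 1 = b.val ∨ b.val + 1 = a.val) := by
  rw [C5plus, SimpleGraph.compl_adj, SimpleGraph.pathGraph_adj]

/-- The `t`-th color of the class `c` modulo three: the `h` colors of the block `c` in increasing
order, followed by those of the next block in decreasing order. -/
def cyclicList (h c t : ℕ) : ℕ :=
  if t < h then c * h + t else (if c = 2 then 0 else c + 1) * h + (2 * h - 1 - t)

/-- A proper coloring of `C5plus` with three colors. -/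
def C5plusClass (v : Fin 5) : ℕ := (v.val + 1) / 2

lemma C5plusClass_lt (v : Fin 5) : C5plusClass v < 3 := by
  unfold C5plusClass; omega

lemma C5plusClass_ne {a b : Fin 5} (h : C5plus.Adj a b) : C5plusClass a ≠ C5plusClass b := by
  rw [C5plus_adj, Ne, Fin.ext_iff] at h
  unfold C5plusClass
  omega

lemma cyclicList_lt {h c t : ℕ} (hc : c < 3) (ht : t < 2 * h) : cyclicList h c t < 3 * h := by
  unfold cyclicList
  interval_cases c <;> split_ifs <;> omega

lemma cyclicList_injOn {h c t u : ℕ} (hc : c < 3) (ht : t < 2 * h) (hu : u < 2 * h)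
    (heq : cyclicList h c t = cyclicList h c u) : t = u := by
  unfold cyclicList at heq
  interval_cases c <;> split_ifs at heq <;> first | contradiction | omega

lemma cyclicList_ne {h c d t u : ℕ} (hc : c < 3) (hd : d < 3) (hcd : c ≠ d)
    (htu : t + u + 2 ≤ 2 * h) : cyclicList h c t ≠ cyclicList h d u := by
  unfold cyclicList
  interval_cases c <;> interval_cases d <;> split_ifs <;> omega

lemma exists_algWins_C5plus {w h : ℕ} (hw : w ≤ 2 * h) :
    ∃ σ, AlgWins C5plus w (3 * h) σ :=
  ⟨listStrategy fun v => cyclicList h (C5plusClass v), algWins_listStrategy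
    (fun v _ ht => cyclicList_lt (C5plusClass_lt v) (ht.trans_le hw))
    (fun v _ ht _ hu => cyclicList_injOn (C5plusClass_lt v) (ht.trans_le hw) (hu.trans_le hw))
    (fun v v' hv _ _ htu => cyclicList_ne (C5plusClass_lt v) (C5plusClass_lt v')
      (C5plusClass_ne hv) (htu.trans hw))⟩

/-- The play that places `m` tokens at `v 0`, then `m` tokens at `v 1`, and so on. -/
def blockPlay {V : Type*} (m : ℕ) (v : ℕ → V) (i : ℕ) : V := v (i / m)

/-- A block play is legal if its blocks can be partitioned into few independent families. -/
lemma legalPlay_blockPlay {V : Type*} {G : SimpleGraph V} {w m r p : ℕ} {v : ℕ → V}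
    (hw : p * m ≤ w) (c : ℕ → ℕ) (hc : ∀ a < r, c a < p)
    (hne : ∀ a < r, ∀ b < r, a ≠ b → c a = c b → v a ≠ v b ∧ ¬G.Adj (v a) (v b)) :
    LegalPlay G w (blockPlay m v) (r * m) := by
  rcases Nat.eq_zero_or_pos m with rfl | hm
  · exact ⟨fun _ => 0, by simp, by simp⟩
  have hdiv : ∀ i < r * m, i / m < r := fun i hi => (Nat.div_lt_iff_lt_mul hm).2 hi
  refine ⟨fun i => c (i / m) * m + i % m, fun i hi => ?_, ?_⟩
  · have h1 := hc _ (hdiv i hi)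
    have h2 := Nat.mod_lt i hm
    calc c (i / m) * m + i % m < (c (i / m) + 1) * m := by rw [add_mul]; omega
      _ ≤ p * m := Nat.mul_le_mul_right _ h1
      _ ≤ w := hw
  · rintro i j hi hj ⟨hij, hadj⟩ heq
    have hmod : i % m = j % m := by
      simpa [Nat.mod_eq_of_lt] using congrArg (· % m) heq
    have hcc : c (i / m) = c (j / m) := by
      simp only [hmod, add_left_inj] at heq
      exact Nat.eq_of_mul_eq_mul_right hm heq
    have hd : i / m ≠ j / m := fun hd => hij (by
      rw [← Nat.div_add_mod i m, ← Nat.div_add_mod j m, hd, hmod])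
    have := hne _ (hdiv i hi) _ (hdiv j hj) hd hcc
    exact hadj.elim this.1 this.2

/-- The set of colors that the strategy `σ` uses on the `q`-th block of a block play. -/
def blockColors {V : Type*} (σ : List V → ℕ) (m : ℕ) (v : ℕ → V) (q : ℕ) : Finset ℕ :=
  (Finset.range m).image fun t => colorOf σ (blockPlay m v) (q * m + t)

lemma blockColors_congr {V : Type*} (σ : List V → ℕ) (m : ℕ) {v v' : ℕ → V} {q : ℕ}
    (h : ∀ a ≤ q, v a = v' a) : blockColors σ m v q = blockColors σ m v' q := by
  apply Finset.image_congr
  intro t ht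
  have ht : t < m := by simpa using ht
  unfold colorOf blockPlay
  dsimp only
  congr 2
  funext j
  apply h
  rw [← Nat.lt_succ_iff, Nat.div_lt_iff_lt_mul (by omega), Nat.succ_mul]
  omega

section

variable {V : Type*} {G : SimpleGraph V} {w k m r : ℕ} {σ : List V → ℕ} {v : ℕ → V}

lemma block_index_lt {q t : ℕ} (hq : q < r) (ht : t < m) : q * m + t < r * m := by
  calc q * m + t < (q + 1) * m := by rw [add_mul]; omega
    _ ≤ r * m := Nat.mul_le_mul_right _ hq

lemma blockPlay_index {q t : ℕ} (ht : t < m) : blockPlay m v (q * m + t) = v q := by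
  rw [blockPlay, mul_comm, Nat.mul_add_div (by omega), Nat.div_eq_of_lt ht, add_zero]

lemma blockColors_subset (hσ : AlgWins G w k σ) (hv : LegalPlay G w (blockPlay m v) (r * m))
    {q : ℕ} (hq : q < r) : blockColors σ m v q ⊆ Finset.range k := by
  intro x hx
  obtain ⟨t, ht, rfl⟩ := Finset.mem_image.1 hx
  exact Finset.mem_range.2 ((hσ _ _ hv).1 _ (block_index_lt hq (Finset.mem_range.1 ht)))

lemma card_blockColors (hσ : AlgWins G w k σ) (hv : LegalPlay G w (blockPlay m v) (r * m))
    {q : ℕ} (hq : q < r) : (blockColors σ m v q).card = m := by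
  rw [blockColors, Finset.card_image_of_injOn, Finset.card_range]
  intro t ht u hu htu
  have ht : t < m := by simpa using ht
  have hu : u < m := by simpa using hu
  by_contra hne
  exact (hσ _ _ hv).2 _ _ (block_index_lt hq ht) (block_index_lt hq hu)
    ⟨by omega, Or.inl (by rw [blockPlay_index ht, blockPlay_index hu])⟩ htu

lemma disjoint_blockColors (hσ : AlgWins G w k σ)
    (hv : LegalPlay G w (blockPlay m v) (r * m)) {p q : ℕ} (hp : p < r) (hq : q < r)
    (hadj : G.Adj (v p) (v q)) : Disjoint (blockColors σ m v p) (blockColors σ m v q) := by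
  rw [Finset.disjoint_left]
  intro x hx hx'
  obtain ⟨t, ht, rfl⟩ := Finset.mem_image.1 hx
  obtain ⟨u, hu, htu⟩ := Finset.mem_image.1 hx'
  rw [Finset.mem_range] at ht hu
  have hadj' : G.Adj (blockPlay m v (p * m + t)) (blockPlay m v (q * m + u)) := by
    rwa [blockPlay_index ht, blockPlay_index hu]
  exact (hσ _ _ hv).2 _ _ (block_index_lt hp ht) (block_index_lt hq hu)
    ⟨fun h => hadj'.ne (congrArg _ h), Or.inr hadj'⟩ htu.symm

end

/-- Spoiler plays `m` tokens at each of the vertices `1` and `2`, and then either `m` tokens at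
`4` or `m` tokens at each of `0` and `3`. -/
lemma AlgWins.five_mul_le_two_mul {w k m : ℕ} {σ : List (Fin 5) → ℕ} (hm : 2 * m ≤ w)
    (hσ : AlgWins C5plus w k σ) : 5 * m ≤ 2 * k := by
  let v : ℕ → Fin 5 := fun q => if q = 0 then 1 else if q = 1 then 2 else 4
  let v' : ℕ → Fin 5 := fun q => if q = 0 then 1 else if q = 1 then 2 else if q = 2 then 0 else 3
  have hv : LegalPlay C5plus w (blockPlay m v) (3 * m) := by
    refine legalPlay_blockPlay hm (fun q => q / 2) (fun a ha => by omega) ?_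
    intro a ha b hb
    interval_cases a <;> interval_cases b <;> simp [v, C5plus_adj]
  have hv' : LegalPlay C5plus w (blockPlay m v') (4 * m) := by
    refine legalPlay_blockPlay hm (fun q => q % 2) (fun a ha => by omega) ?_
    intro a ha b hb
    interval_cases a <;> interval_cases b <;> simp [v', C5plus_adj]
  have h0 : blockColors σ m v 0 = blockColors σ m v' 0 :=
    blockColors_congr σ m fun a ha => by interval_cases a; rfl
  have h1 : blockColors σ m v 1 = blockColors σ m v' 1 :=
    blockColors_congr σ m fun a ha => by interval_cases a <;> rfl
  have c0 := card_blockColors hσ hv (q := 0) (by omega)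
  have c1 := card_blockColors hσ hv (q := 1) (by omega)
  have c2 := card_blockColors hσ hv (q := 2) (by omega)
  have c2' := card_blockColors hσ hv' (q := 2) (by omega)
  have c3' := card_blockColors hσ hv' (q := 3) (by omega)
  have s0 := blockColors_subset hσ hv (q := 0) (by omega)
  have s1 := blockColors_subset hσ hv (q := 1) (by omega)
  have s2 := blockColors_subset hσ hv (q := 2) (by omega)
  have s2' := blockColors_subset hσ hv' (q := 2) (by omega)
  have s3' := blockColors_subset hσ hv' (q := 3) (by omega)
  have d02 := disjoint_blockColors hσ hv (p := 0) (q := 2) (by omega) (by omega)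
    (by simp [v, C5plus_adj])
  have d12 := disjoint_blockColors hσ hv (p := 1) (q := 2) (by omega) (by omega)
    (by simp [v, C5plus_adj])
  have d12' := disjoint_blockColors hσ hv' (p := 1) (q := 2) (by omega) (by omega)
    (by simp [v', C5plus_adj])
  have d03' := disjoint_blockColors hσ hv' (p := 0) (q := 3) (by omega) (by omega)
    (by simp [v', C5plus_adj])
  have d23' := disjoint_blockColors hσ hv' (p := 2) (q := 3) (by omega) (by omega)
    (by simp [v', C5plus_adj])
  rw [← h1] at d12'
  rw [← h0] at d03'
  have e1 := Finset.card_le_card (Finset.union_subset (Finset.union_subset s0 s1) s2)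
  have e2 := Finset.card_le_card (Finset.union_subset (Finset.union_subset s2' s3')
    (Finset.inter_subset_left.trans s0 :
      blockColors σ m v 0 ∩ blockColors σ m v 1 ⊆ Finset.range k))
  rw [Finset.card_union_of_disjoint (Finset.disjoint_union_left.2 ⟨d02, d12⟩),
    Finset.card_range] at e1
  rw [Finset.card_union_of_disjoint (Finset.disjoint_union_left.2
      ⟨(d12'.mono_left Finset.inter_subset_right).symm,
        (d03'.mono_left Finset.inter_subset_left).symm⟩),
    Finset.card_union_of_disjoint d23', Finset.card_range] at e2
  have := Finset.card_union_add_card_inter (blockColors σ m v 0) (blockColors σ m v 1)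
  omega

/-- For every positive integer `w`, `(5/2)·⌊w/2⌋ ≤ f(w, C₅⁺) ≤ 3·⌈w/2⌉`. -/
theorem gameValue_C5plus (w : ℕ) (hw : 0 < w) :
    (5 / 2 : ℚ) * ((w / 2 : ℕ) : ℚ) ≤ (gameValue C5plus w : ℚ) ∧
      (gameValue C5plus w : ℚ) ≤ 3 * (⌈(w : ℚ) / 2⌉ : ℚ) := by
  obtain ⟨h, hh⟩ := Int.eq_ofNat_of_zero_le (Int.ceil_nonneg (by positivity : 0 ≤ (w : ℚ) / 2))
  have hwh : w ≤ 2 * h := by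
    have := Int.le_ceil ((w : ℚ) / 2)
    rw [hh, Int.cast_natCast] at this
    have : (w : ℚ) ≤ 2 * h := by linarith
    exact_mod_cast this
  have hmem := exists_algWins_C5plus hwh
  constructor
  · obtain ⟨σ, hσ⟩ := Nat.sInf_mem (s := {k | ∃ σ, AlgWins C5plus w k σ}) ⟨_, hmem⟩
    have : 5 * (w / 2) ≤ 2 * gameValue C5plus w := hσ.five_mul_le_two_mul (by omega)
    have : (5 : ℚ) * ((w / 2 : ℕ) : ℚ) ≤ 2 * gameValue C5plus w := by exact_mod_cast this
    linarith
  · rw [hh, Int.cast_natCast]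
    exact_mod_cast Nat.sInf_le hmem
end

section
/- For every positive integer w, h(w) ≥ ⌊(3/2)·w⌋; that is, in the online interval coloring game on the real line of width w, Spoiler has a strategy forcing Algorithm to use at least ⌊3w/2⌋ colors. -/
/-- The graph `𝔾` on the real line: vertices are the real numbers, with `u` and `v`
adjacent if and only if they are distinct and `|u - v| < 1`.  The online interval
coloring game on the real line of width `w` has value `h(w) = f(w, 𝔾)`. -/
def lineGraph : SimpleGraph ℝ := SimpleGraph.fromRel (fun u v => |u - v| < 1)

theorem tokenAdj_lineGraph_iff {s : ℕ → ℝ} {i j : ℕ} :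
    TokenAdj lineGraph s i j ↔ i ≠ j ∧ |s i - s j| < 1 := by
  unfold TokenAdj lineGraph
  rw [SimpleGraph.fromRel_adj, abs_sub_comm (s j), or_self]
  refine and_congr_right fun _ => ⟨?_, fun h => ?_⟩
  · rintro (h | h)
    · simp [h]
    · exact h.2
  · by_cases e : s i = s j
    · exact Or.inl e
    · exact Or.inr ⟨e, h⟩

/-- An online color depends only on the moves played so far. -/
theorem colorOf_congr {V : Type*} (σ : List V → ℕ) {s t : ℕ → V} {i : ℕ}
    (h : ∀ j ≤ i, s j = t j) : colorOf σ s i = colorOf σ t i := by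
  unfold colorOf
  congr 2
  funext j
  exact h j (by omega)

theorem Finset.exists_injOn_lt_card (S : Finset ℕ) :
    ∃ f : ℕ → ℕ, (∀ i ∈ S, f i < S.card) ∧ Set.InjOn f S := by
  refine ⟨fun i => if h : i ∈ S then S.equivFin ⟨i, h⟩ else 0, fun i hi => ?_, ?_⟩
  · simp [hi]
  · intro i hi j hj h
    have hi' : i ∈ S := hi
    have hj' : j ∈ S := hj
    simpa [hi', hj', Fin.val_inj] using h

/-- Algorithm's strategy that splits the line into half-open unit blocks and colors a token by
its rank within its block together with the parity of the block. -/
noncomputable def blockStrategy (l : List ℝ) : ℕ :=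
  2 * (l.dropLast.filter fun y => ⌊y⌋ = ⌊l.getLastD 0⌋).length + (⌊l.getLastD 0⌋ % 2).toNat

theorem colorOf_blockStrategy (s : ℕ → ℝ) (i : ℕ) :
    colorOf blockStrategy s i =
      2 * ((Finset.range i).filter fun j => ⌊s j⌋ = ⌊s i⌋).card + (⌊s i⌋ % 2).toNat := by
  have h : (List.ofFn fun j : Fin (i + 1) => s j) = (List.range i).map s ++ [s i] := by
    rw [List.ofFn_eq_map, ← List.map_coe_finRange_eq_range, List.map_map,
      List.finRange_succ_last]
    simp [Function.comp_def]
  unfold colorOf blockStrategy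
  rw [h]
  simp only [List.dropLast_concat, List.getLastD_concat, List.filter_map, List.length_map]
  congr 2

theorem algWins_blockStrategy (w : ℕ) : AlgWins lineGraph w (2 * w) blockStrategy := by
  rintro n s ⟨φ, hφ, hne⟩
  have floor_adj : ∀ i j, i ≠ j → ⌊s i⌋ = ⌊s j⌋ → TokenAdj lineGraph s i j := fun i j h e =>
    tokenAdj_lineGraph_iff.2 ⟨h, Int.abs_sub_lt_one_of_floor_eq_floor e⟩
  constructor
  · intro i hi
    rw [colorOf_blockStrategy]
    have hcard : (insert i ((Finset.range i).filter fun j => ⌊s j⌋ = ⌊s i⌋)).card ≤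
        (Finset.range w).card := by
      have hmem : ∀ a ∈ insert i ((Finset.range i).filter fun j => ⌊s j⌋ = ⌊s i⌋),
          a < n ∧ ⌊s a⌋ = ⌊s i⌋ := by
        intro a ha
        simp only [Finset.mem_insert, Finset.mem_filter, Finset.mem_range] at ha
        rcases ha with rfl | ⟨h1, h2⟩
        · exact ⟨hi, rfl⟩
        · exact ⟨by omega, h2⟩
      refine Finset.card_le_card_of_injOn φ (fun a ha => ?_) fun a ha b hb hab => ?_
      · simpa using hφ a (hmem a ha).1
      · by_contra hne'
        exact hne a b (hmem a ha).1 (hmem b hb).1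
          (floor_adj a b hne' ((hmem a ha).2.trans (hmem b hb).2.symm)) hab
    rw [Finset.card_insert_of_notMem (by simp), Finset.card_range] at hcard
    omega
  · suffices H : ∀ i j, i < j → TokenAdj lineGraph s i j →
        colorOf blockStrategy s i ≠ colorOf blockStrategy s j by
      intro i j _ _ h
      rcases lt_or_gt_of_ne h.1 with h' | h'
      · exact H i j h' h
      · refine (H j i h' ?_).symm
        rw [tokenAdj_lineGraph_iff] at h ⊢
        rwa [abs_sub_comm, ne_comm]
    intro i j hij h hc
    have hd := (tokenAdj_lineGraph_iff.1 h).2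
    rw [colorOf_blockStrategy, colorOf_blockStrategy] at hc
    have hp : ⌊s i⌋ % 2 = ⌊s j⌋ % 2 := by omega
    have hf : ⌊s i⌋ = ⌊s j⌋ := by
      rw [abs_lt] at hd
      have h1 : ⌊s i⌋ < ⌊s j⌋ + 2 := by
        have := Int.floor_le (s i)
        have := Int.lt_floor_add_one (s j)
        have : ((⌊s i⌋ : ℤ) : ℝ) < ((⌊s j⌋ + 2 : ℤ) : ℝ) := by push_cast; linarith
        exact_mod_cast this
      have h2 : ⌊s j⌋ < ⌊s i⌋ + 2 := by
        have := Int.floor_le (s j)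
        have := Int.lt_floor_add_one (s i)
        have : ((⌊s j⌋ : ℤ) : ℝ) < ((⌊s i⌋ + 2 : ℤ) : ℝ) := by push_cast; linarith
        exact_mod_cast this
      omega
    rw [hf] at hc
    have hlt : ((Finset.range i).filter fun a => ⌊s a⌋ = ⌊s j⌋).card <
        ((Finset.range j).filter fun a => ⌊s a⌋ = ⌊s j⌋).card := by
      refine Finset.card_lt_card (Finset.ssubset_iff_subset_ne.2 ⟨fun a ha => ?_, fun he => ?_⟩)
      · simp only [Finset.mem_filter, Finset.mem_range] at ha ⊢
        exact ⟨by omega, ha.2⟩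
      · have : i ∈ (Finset.range j).filter fun a => ⌊s a⌋ = ⌊s j⌋ := by simp [hij, hf]
        rw [← he] at this
        simp at this
    omega

/-- Spoiler's separation strategy: after `k` tokens at `0`, Spoiler plays `n` tokens in a short
interval so that up to `k` tokens with colors outside `A`, indexed by `L`, end up to the left of
all the other ones. -/
theorem exists_separating_play (σ : List ℝ → ℕ) (A : Finset ℕ) (k n : ℕ) :
    ∃ (s : ℕ → ℝ) (L : Finset ℕ) (l r : ℝ), (∀ i < k, s i = 0) ∧ L ⊆ Finset.Ico k (k + n) ∧
      L.card ≤ k ∧ 6 / 5 ≤ l ∧ l < r ∧ r ≤ 7 / 5 ∧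
      (∀ i ∈ L, 6 / 5 ≤ s i ∧ s i ≤ l ∧ colorOf σ s i ∉ A) ∧
      ∀ i ∈ Finset.Ico k (k + n) \ L, r ≤ s i ∧ s i ≤ 7 / 5 ∧
        (colorOf σ s i ∈ A ∨ L.card = k) := by
  induction n with
  | zero => exact ⟨fun _ => 0, ∅, 6 / 5, 7 / 5, by norm_num⟩
  | succ n ih =>
    obtain ⟨s, L, l, r, h0, hL, hLk, hl, hlr, hr, hleft, hright⟩ := ih
    set m := (l + r) / 2 with hm
    set t := Function.update s (k + n) m with ht
    have hlm : l < m := by linarith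
    have hmr : m < r := by linarith
    have htn : t (k + n) = m := by simp [ht]
    have hts : ∀ i, i < k + n → t i = s i := fun i hi => by
      simp [ht, Function.update_of_ne hi.ne]
    have hcol : ∀ i, i < k + n → colorOf σ t i = colorOf σ s i := fun i hi =>
      colorOf_congr σ fun j hj => hts j (by omega)
    have hLlt : ∀ i ∈ L, i < k + n := fun i hi => (Finset.mem_Ico.1 (hL hi)).2
    have hnL : k + n ∉ L := fun h => (hLlt _ h).false
    have ht0 : ∀ i < k, t i = 0 := fun i hi => (hts i (by omega)).trans (h0 i hi)
    have hsub : Finset.Ico k (k + n) ⊆ Finset.Ico k (k + (n + 1)) :=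
      Finset.Ico_subset_Ico_right (by omega)
    by_cases hc : colorOf σ t (k + n) ∉ A ∧ L.card < k
    · refine ⟨t, insert (k + n) L, m, r, ht0, ?_, ?_, by linarith, hmr, hr, ?_, ?_⟩
      · exact Finset.insert_subset (by simp) (hL.trans hsub)
      · rw [Finset.card_insert_of_notMem hnL]
        exact hc.2
      · intro i hi
        rcases Finset.mem_insert.1 hi with rfl | hi
        · exact ⟨by linarith, htn.le, hc.1⟩
        · obtain ⟨h1, h2, h3⟩ := hleft i hi
          rw [hts i (hLlt i hi), hcol i (hLlt i hi)]
          exact ⟨h1, by linarith, h3⟩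
      · intro i hi
        simp only [Finset.mem_sdiff, Finset.mem_Ico, Finset.mem_insert, not_or] at hi
        have hin : i < k + n := by omega
        obtain ⟨h1, h2, h3⟩ := hright i (by simp [hi.1.1, hi.2.2, hin])
        rw [hts i hin, hcol i hin]
        exact ⟨h1, h2, Or.inl (h3.resolve_right (by omega))⟩
    · refine ⟨t, L, l, m, ht0, hL.trans hsub, hLk, hl, hlm, by linarith, ?_, ?_⟩
      · intro i hi
        rw [hts i (hLlt i hi), hcol i (hLlt i hi)]
        exact hleft i hi
      · intro i hi
        simp only [Finset.mem_sdiff, Finset.mem_Ico] at hi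
        rcases eq_or_ne i (k + n) with rfl | hne
        · refine ⟨htn.ge, by linarith, ?_⟩
          by_cases hA : colorOf σ t (k + n) ∈ A
          · exact Or.inl hA
          · exact Or.inr (by by_contra; exact hc ⟨hA, by omega⟩)
        · have hin : i < k + n := by omega
          obtain ⟨h1, h2, h3⟩ := hright i (by simp [hi.1.1, hi.2, hin])
          rw [hts i hin, hcol i hin]
          exact ⟨by linarith, h2, h3⟩

theorem AlgWins.add_half_le {w K : ℕ} {σ : List ℝ → ℕ} (hσ : AlgWins lineGraph w K σ) :
    w + w / 2 ≤ K := by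
  set k := w / 2 with hk
  have hkw : 2 * k ≤ w := by omega
  set A := (Finset.range k).image (colorOf σ fun _ => (0 : ℝ)) with hA
  obtain ⟨s, L, l, r, h0, hL, hLk, hl, hlr, hr, hleft, hright⟩ :=
    exists_separating_play σ A k (2 * k)
  have hmid : ∀ i, k ≤ i → i < k + 2 * k → 6 / 5 ≤ s i ∧ s i ≤ 7 / 5 := by
    intro i h1 h2
    by_cases hi : i ∈ L
    · have := hleft i hi
      exact ⟨this.1, by linarith⟩
    · have := hright i (by simp [h1, h2, hi])
      exact ⟨by linarith, this.2.1⟩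
  have hproper := hσ (k + 2 * k) s ⟨fun i => if i < k then i else i - k, by
    intro i hi
    dsimp only
    split_ifs <;> omega, by
    intro i j hi hj hadj
    rw [tokenAdj_lineGraph_iff, abs_lt] at hadj
    dsimp only
    split_ifs with h1 h2 h2
    · exact hadj.1
    · have := h0 i h1
      have := hmid j (by omega) hj
      linarith
    · have := h0 j h2
      have := hmid i (by omega) hi
      linarith
    · omega⟩
  have hcardL : L.card = k := by
    by_contra hne
    have hle : (Finset.Ico k (k + 2 * k) \ L).card ≤ A.card := by
      refine Finset.card_le_card_of_injOn (colorOf σ s) (fun i hi => ?_) fun i hi j hj hij => ?_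
      · exact (hright i hi).2.2.resolve_right hne
      · simp only [Finset.coe_sdiff, Finset.coe_Ico, Set.mem_sdiff, Set.mem_Ico] at hi hj
        by_contra hne'
        refine hproper.2 i j hi.1.2 hj.1.2 (tokenAdj_lineGraph_iff.2 ⟨hne', ?_⟩) hij
        have := hmid i hi.1.1 hi.1.2
        have := hmid j hj.1.1 hj.1.2
        rw [abs_lt]
        constructor <;> linarith
    have hAk : A.card ≤ k := Finset.card_image_le.trans (Finset.card_range k).le
    rw [Finset.card_sdiff_of_subset hL, Nat.card_Ico] at hle
    omega
  have hcardR : (Finset.Ico k (k + 2 * k) \ L).card = k := by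
    rw [Finset.card_sdiff_of_subset hL, Nat.card_Ico]
    omega
  obtain ⟨f, hf, hfinj⟩ := Finset.exists_injOn_lt_card L
  obtain ⟨g, hg, hginj⟩ := Finset.exists_injOn_lt_card (Finset.Ico k (k + 2 * k) \ L)
  rw [hcardL] at hf
  rw [hcardR] at hg
  have hLmem : ∀ i ∈ L, k ≤ i ∧ i < k + 2 * k := fun i hi => Finset.mem_Ico.1 (hL hi)
  have hRmem : ∀ i, k ≤ i → i < k + 2 * k → i ∉ L → i ∈ Finset.Ico k (k + 2 * k) \ L :=
    fun i h1 h2 h3 => by simp [h1, h2, h3]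
  set t : ℕ → ℝ := fun i => if i < k + 2 * k then s i else r - 1 with ht
  have hts : ∀ i, i < k + 2 * k → t i = s i := fun i hi => by simp [ht, hi]
  have htm : ∀ i, ¬ i < k + 2 * k → t i = r - 1 := fun i hi => by simp [ht, hi]
  have hcol : ∀ i, i < k + 2 * k → colorOf σ t i = colorOf σ s i := fun i hi =>
    colorOf_congr σ fun j hj => hts j (by omega)
  set φ : ℕ → ℕ := fun i =>
    if i < k then i else if i < k + 2 * k then if i ∈ L then f i else k + g i else i - 2 * k
    with hφ
  have hlegal : LegalPlay lineGraph w t (2 * k + w) := by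
    have H : ∀ i j, i < j → j < 2 * k + w → |t i - t j| < 1 → φ i ≠ φ j := by
      intro i j hij hj hadj
      rw [abs_lt] at hadj
      by_cases hjk : j < k
      · simp only [hφ, hjk, hij.trans hjk, if_true]
        omega
      by_cases hik : i < k
      · by_cases hjm : j < k + 2 * k
        · rw [hts i (by omega), hts j hjm, h0 i hik] at hadj
          have := hmid j (by omega) hjm
          linarith
        · simp only [hφ, hjk, hik, hjm, if_true, if_false]
          omega
      by_cases hjm : j < k + 2 * k
      · have him : i < k + 2 * k := by omega
        by_cases hiL : i ∈ L <;> by_cases hjL : j ∈ L <;>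
          simp only [hφ, hik, hjk, hjm, him, hiL, hjL, if_true, if_false]
        · exact fun h => hij.ne (hfinj hiL hjL h)
        · have := hf i hiL
          omega
        · have := hf j hjL
          omega
        · exact fun h => hij.ne (hginj (hRmem i (by omega) him hiL)
            (hRmem j (by omega) hjm hjL) (by omega))
      by_cases him : i < k + 2 * k
      · by_cases hiL : i ∈ L
        · have := hf i hiL
          simp only [hφ, hik, hjk, hjm, him, hiL, if_true, if_false]
          omega
        · have := hright i (hRmem i (by omega) him hiL)
          rw [hts i him, htm j hjm] at hadj
          linarith
      · simp only [hφ, hik, hjk, hjm, him, if_false]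
        omega
    refine ⟨φ, fun i hi => ?_, fun i j hi hj hadj => ?_⟩
    · by_cases hik : i < k
      · simp only [hφ, hik, if_true]
        omega
      by_cases him : i < k + 2 * k
      · by_cases hiL : i ∈ L
        · have := hf i hiL
          simp only [hφ, hik, him, hiL, if_true, if_false]
          omega
        · have := hg i (hRmem i (by omega) him hiL)
          simp only [hφ, hik, him, hiL, if_true, if_false]
          omega
      · simp only [hφ, hik, him, if_false]
        omega
    · rw [tokenAdj_lineGraph_iff] at hadj
      rcases lt_or_gt_of_ne hadj.1 with h | h
      · exact H i j h hj hadj.2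
      · exact (H j i h hi (by rw [abs_sub_comm]; exact hadj.2)).symm
  obtain ⟨hlt, hne⟩ := hσ _ t hlegal
  have hadj : ∀ i j, i < j → j < 2 * k + w → (i ∉ L → i < k ∨ k + 2 * k ≤ i) →
      (j ∉ L → j < k ∨ k + 2 * k ≤ j) → colorOf σ t i ≠ colorOf σ t j := by
    intro i j hij hj hi' hj'
    have near : |t i - t j| < 1 → colorOf σ t i ≠ colorOf σ t j := fun h =>
      hne i j (by omega) hj (tokenAdj_lineGraph_iff.2 ⟨hij.ne, h⟩)
    by_cases hjL : j ∈ L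
    · have hj3 := hLmem j hjL
      have hcj := hleft j hjL
      by_cases hiL : i ∈ L
      · apply near
        have := hleft i hiL
        rw [hts i (by omega), hts j hj3.2, abs_lt]
        constructor <;> linarith
      · have hik : i < k := by have := hi' hiL; omega
        rw [hcol j hj3.2]
        intro h
        refine hcj.2.2 (h ▸ Finset.mem_image.2 ⟨i, Finset.mem_range.2 hik, ?_⟩)
        exact colorOf_congr σ fun a ha =>
          ((hts a (by omega)).trans (h0 a (by omega))).symm
    apply near
    rcases hj' hjL with hjk | hjm
    · rw [hts i (by omega), hts j (by omega), h0 i (by omega), h0 j hjk]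
      norm_num
    · rw [htm j (by omega)]
      by_cases hiL : i ∈ L
      · have := hleft i hiL
        rw [hts i (hLmem i hiL).2, abs_lt]
        constructor <;> linarith
      · rcases hi' hiL with hik | him
        · rw [hts i (by omega), h0 i hik, abs_lt]
          constructor <;> linarith
        · rw [htm i (by omega)]
          norm_num
  set S := Finset.range (2 * k + w) \ (Finset.Ico k (k + 2 * k) \ L) with hS
  have hSmem : ∀ i ∈ S, i < 2 * k + w ∧ (i ∉ L → i < k ∨ k + 2 * k ≤ i) := by
    intro i hi
    simp only [hS, Finset.mem_sdiff, Finset.mem_range, Finset.mem_Ico] at hi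
    exact ⟨hi.1, fun h => by by_contra h'; exact hi.2 ⟨by omega, h⟩⟩
  have hcard : S.card ≤ (Finset.range K).card := by
    refine Finset.card_le_card_of_injOn (colorOf σ t) (fun i hi => ?_) fun i hi j hj hij => ?_
    · simpa using hlt i (hSmem i hi).1
    · obtain ⟨hi1, hi2⟩ := hSmem i hi
      obtain ⟨hj1, hj2⟩ := hSmem j hj
      rcases lt_trichotomy i j with h | h | h
      · exact absurd hij (hadj i j h hj1 hi2 hj2)
      · exact h
      · exact absurd hij.symm (hadj j i h hi1 hj2 hi2)
  have hsub : Finset.Ico k (k + 2 * k) \ L ⊆ Finset.range (2 * k + w) := by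
    intro i hi
    simp only [Finset.mem_sdiff, Finset.mem_Ico] at hi
    exact Finset.mem_range.2 (by omega)
  rw [hS, Finset.card_sdiff_of_subset hsub, hcardR, Finset.card_range, Finset.card_range] at hcard
  omega

/-- For every positive integer `w`, `h(w) ≥ ⌊(3/2)·w⌋`: in the online interval coloring
game on the real line of width `w`, Spoiler can force at least `⌊3w/2⌋` colors. -/
theorem lineGame_lower (w : ℕ) (hw : 0 < w) :
    3 * w / 2 ≤ gameValue lineGraph w := by
  refine le_csInf ⟨2 * w, blockStrategy, algWins_blockStrategy w⟩ ?_
  rintro K ⟨σ, hσ⟩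
  have := hσ.add_half_le
  omega
end
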